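/- For every nonzero F ∈ 𝒜 one has the strict inequality max{‖𝓗(F)‖_{L∞(ℝ)}, ‖𝓗(f_F)‖_{L∞(ℝ/ℤ)}} > ‖F‖_{L¹(ℝ)}; in particular there is no extremal function in 𝒜 for the extremal problem (EP1), whose optimal constant is 1. -/

import Mathlib

open MeasureTheory

/-- `e t = e^{2πit}`. -/
noncomputable def e (t : ℝ) : ℂ := Complex.exp (2 * Real.pi * Complex.I * t)

/-- Fourier transform `F̂(t) = ∫ F(x) e^{-2πitx} dx`. -/
noncomputable def FT (F : ℝ → ℝ) (t : ℝ) : ℂ :=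
  ∫ x : ℝ, (F x : ℂ) * Complex.exp (-(2 * Real.pi * Complex.I) * t * x)

/-- Hilbert transform on `ℝ` via the multiplier `-i sgn(t)` and Fourier inversion. -/
noncomputable def HilbR (F : ℝ → ℝ) (x : ℝ) : ℂ :=
  ∫ t : ℝ, -Complex.I * (Real.sign t : ℂ) * FT F t * Complex.exp (2 * Real.pi * Complex.I * t * x)

/-- Hilbert transform on `ℝ/ℤ` of the periodization of `F_δ`, via the multiplier `-i sgn(k)`. -/
noncomputable def HilbPer (F : ℝ → ℝ) (δ : ℝ) (θ : ℝ) : ℂ :=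
  ∑' k : ℤ, -Complex.I * (Int.sign k : ℂ) * FT F (δ * k) *
    Complex.exp (2 * Real.pi * Complex.I * k * θ)

/-- The class `𝒜`: even, continuous, nonnegative, supported in `[-1/2,1/2]`, with `F̂ ∈ L¹`. -/
def memA (F : ℝ → ℝ) : Prop :=
  Continuous F ∧ (∀ x, F (-x) = F x) ∧ (∀ x, 0 ≤ F x) ∧
    (∀ x : ℝ, x ∉ Set.Icc (-(1/2) : ℝ) (1/2) → F x = 0) ∧
    MeasureTheory.Integrable (FT F)

/-- `‖𝓗(F)‖_{L^∞(ℝ)}` (sup norm of a bounded continuous function). -/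
noncomputable def supHR (F : ℝ → ℝ) : ℝ := ⨆ x : ℝ, ‖HilbR F x‖

/-- `‖𝓗(f_δ)‖_{L^∞(ℝ/ℤ)}` (sup norm of a bounded continuous function). -/
noncomputable def supHPer (F : ℝ → ℝ) (δ : ℝ) : ℝ := ⨆ θ : ℝ, ‖HilbPer F δ θ‖

/-- `𝒞(F) = max{‖𝓗(F)‖_{L∞(ℝ)}, ‖𝓗(f_F)‖_{L∞(ℝ/ℤ)}}`. -/
noncomputable def CF (F : ℝ → ℝ) : ℝ := max (supHR F) (supHPer F 1)


lemma aux_root (z : ℂ) (hz : z.im ≠ 0) :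
    ∃ a b : ℂ, a * b = 1 ∧ a + b = 4 * z ∧ ‖a‖ < 1 ∧ 1 < ‖b‖ := by
  obtain ⟨s, hs⟩ := IsAlgClosed.exists_pow_nat_eq (4 * z ^ 2 - 1) (n := 2) (by norm_num)
  have hp : (2 * z + s) * (2 * z - s) = 1 := by linear_combination -hs
  have hn : ‖2 * z + s‖ * ‖2 * z - s‖ = 1 := by rw [← norm_mul, hp, norm_one]
  have h1 : ‖2 * z + s‖ ≠ 1 := by
    intro h
    have hb : 2 * z - s = (starRingEnd ℂ) (2 * z + s) := by
      have h2 : (2 * z + s) * (starRingEnd ℂ) (2 * z + s) = 1 := by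
        rw [Complex.mul_conj, Complex.normSq_eq_norm_sq, h]; simp
      have h0 : (2 * z + s) ≠ 0 := by
        intro h0; rw [h0] at hp; simp at hp
      exact mul_left_cancel₀ h0 (hp.trans h2.symm)
    have h3 := congrArg Complex.im hb
    rw [Complex.conj_im] at h3
    simp at h3
    apply hz; linarith
  have hpos : 0 ≤ ‖2 * z - s‖ := norm_nonneg _
  have hpos2 : 0 ≤ ‖2 * z + s‖ := norm_nonneg _
  rcases lt_or_gt_of_ne h1 with h | h
  · exact ⟨2 * z + s, 2 * z - s, hp, by ring, h, by nlinarith⟩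
  · exact ⟨2 * z - s, 2 * z + s, by rw [mul_comm]; exact hp, by ring, by nlinarith, h⟩

lemma aux_cauchy (z : ℂ) (hz : z.im ≠ 0) :
    (∫ φ in (0:ℝ)..2 * Real.pi, (((Real.cos φ : ℝ) : ℂ) / 2 - z)⁻¹) ^ 2 * (z ^ 2 - 1 / 4)
      = 4 * Real.pi ^ 2 := by
  obtain ⟨a, b, hab, hs, ha, hb⟩ := aux_root z hz
  have hd : DifferentiableOn ℂ (fun η : ℂ => 4 * (η - b)⁻¹) (Metric.closedBall 0 1) := by
    intro η hη
    have : η - b ≠ 0 := by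
      intro h
      rw [sub_eq_zero.1 h] at hη
      simp at hη
      linarith
    exact ((differentiableAt_id.sub_const b).inv this).const_mul 4 |>.differentiableWithinAt
  have hC := hd.circleIntegral_sub_inv_smul (w := a) (by simpa using ha)
  have hab' : a - b ≠ 0 := by
    intro h; rw [sub_eq_zero.1 h] at ha; linarith
  have hpt : ∀ φ : ℝ, deriv (circleMap 0 1) φ • ((circleMap 0 1 φ - a)⁻¹ • (4 * (circleMap 0 1 φ - b)⁻¹))
      = Complex.I * (((Real.cos φ : ℝ) : ℂ) / 2 - z)⁻¹ := by
    intro φ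
    set η := circleMap 0 1 φ with hη
    have hη1 : ‖η‖ = 1 := by simp [hη]
    have hη0 : η ≠ 0 := by intro h; rw [h] at hη1; simp at hη1
    have h1 : η - a ≠ 0 := by
      intro h; rw [sub_eq_zero.1 h] at hη1; linarith
    have h2 : η - b ≠ 0 := by
      intro h; rw [sub_eq_zero.1 h] at hη1; linarith
    have hcos : ((Real.cos φ : ℝ) : ℂ) = (η + η⁻¹) / 2 := by
      rw [hη, circleMap, Complex.ofReal_cos, Complex.cos]
      simp [← Complex.exp_neg]
    have key : ((Real.cos φ : ℝ) : ℂ) / 2 - z = (η - a) * (η - b) / (4 * η) := by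
      rw [hcos]
      field_simp
      linear_combination (4 * η) * hs - 4 * hab
    rw [key, deriv_circleMap, ← hη]
    simp only [smul_eq_mul]
    field_simp
  rw [circleIntegral] at hC
  simp_rw [hpt] at hC
  rw [intervalIntegral.integral_const_mul] at hC
  have hT : (∫ φ in (0:ℝ)..2 * Real.pi, (((Real.cos φ : ℝ) : ℂ) / 2 - z)⁻¹)
      = 8 * Real.pi * (a - b)⁻¹ := by
    apply mul_left_cancel₀ Complex.I_ne_zero
    rw [hC]; simp only [smul_eq_mul]; ring
  rw [hT]
  field_simp
  have : z = (a + b) / 4 := by rw [hs]; ring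
  rw [this]
  linear_combination 64 * hab

lemma aux_cos_sub_ne (z : ℂ) (hz : z.im ≠ 0) (u : ℝ) : (u : ℂ) - z ≠ 0 := by
  intro h
  have := congrArg Complex.im h
  simp at this
  exact hz this

/-- real part of the kernel integral -/
lemma aux_psi (y ε : ℝ) (hε : 0 < ε) :
    ∃ w : ℂ, w ^ 2 * (((y : ℂ) + ε * Complex.I) ^ 2 - 1 / 4) = ((y : ℂ) + ε * Complex.I) ^ 2 ∧
    (∫ φ in (0:ℝ)..2 * Real.pi, (Real.cos φ / 4) *
      (Real.pi⁻¹ * ((Real.cos φ / 2 - y) / ((Real.cos φ / 2 - y) ^ 2 + ε ^ 2)))) = 1 + w.re := by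
  set z : ℂ := (y : ℂ) + ε * Complex.I with hzdef
  have hz : z.im ≠ 0 := by simp [hzdef]; exact hε.ne'
  have hne : ∀ φ : ℝ, ((Real.cos φ : ℝ) : ℂ) / 2 - z ≠ 0 := by
    intro φ
    have := aux_cos_sub_ne z hz (Real.cos φ / 2)
    push_cast at this ⊢
    exact this
  set T := ∫ φ in (0:ℝ)..2 * Real.pi, (((Real.cos φ : ℝ) : ℂ) / 2 - z)⁻¹ with hT
  have hc : Continuous fun φ : ℝ => (((Real.cos φ : ℝ) : ℂ) / 2 - z)⁻¹ := by
    apply Continuous.inv₀ (by fun_prop) hne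
  refine ⟨z * T / (2 * Real.pi), ?_, ?_⟩
  · have := aux_cauchy z hz
    rw [← hT] at this
    have hpi : (Real.pi : ℂ) ≠ 0 := by exact_mod_cast Real.pi_ne_zero
    field_simp
    linear_combination (4 * z ^ 2) * this
  · have hpt : ∀ φ : ℝ, (Real.cos φ / 4) *
      (Real.pi⁻¹ * ((Real.cos φ / 2 - y) / ((Real.cos φ / 2 - y) ^ 2 + ε ^ 2)))
      = RCLike.re ((1 / (2 * Real.pi) : ℂ) + z / (2 * Real.pi) * (((Real.cos φ : ℝ) : ℂ) / 2 - z)⁻¹) := by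
      intro φ
      have h1 : (1 / (2 * Real.pi) : ℂ) + z / (2 * Real.pi) * (((Real.cos φ : ℝ) : ℂ) / 2 - z)⁻¹
        = (((Real.cos φ / 4 * Real.pi⁻¹ : ℝ)) : ℂ) * (((Real.cos φ : ℝ) : ℂ) / 2 - z)⁻¹ := by
        have := hne φ
        have hpi : (Real.pi : ℂ) ≠ 0 := by exact_mod_cast Real.pi_ne_zero
        generalize hcc : ((Real.cos φ : ℝ) : ℂ) = c at this
        push_cast [hcc]
        generalize hD : c / 2 - z = D at this
        have hz' : z = c / 2 - D := by rw [← hD]; ring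
        rw [hz']
        field_simp
        ring
      rw [h1, RCLike.re_to_complex, Complex.re_ofReal_mul, Complex.inv_re, Complex.normSq_apply]
      have e1 : (((Real.cos φ : ℝ) : ℂ) / 2 - z).re = Real.cos φ / 2 - y := by
        rw [Complex.sub_re, show (((Real.cos φ : ℝ) : ℂ) / 2) = ((Real.cos φ / 2 : ℝ) : ℂ) by push_cast; rfl, Complex.ofReal_re]
        simp [hzdef]
      have e2 : (((Real.cos φ : ℝ) : ℂ) / 2 - z).im = - ε := by
        rw [Complex.sub_im, show (((Real.cos φ : ℝ) : ℂ) / 2) = ((Real.cos φ / 2 : ℝ) : ℂ) by push_cast; rfl, Complex.ofReal_im]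
        simp [hzdef]
      rw [e1, e2]
      ring
    simp_rw [hpt]
    rw [intervalIntegral.integral_of_le (by positivity), integral_re, ← intervalIntegral.integral_of_le (by positivity)]
    · rw [intervalIntegral.integral_add, intervalIntegral.integral_const_mul, intervalIntegral.integral_const, ← hT]
      · rw [RCLike.re_to_complex, Complex.add_re]
        congr 1
        · rw [sub_zero, Complex.smul_re]
          have : (1 / (2 * Real.pi) : ℂ) = ((1 / (2 * Real.pi) : ℝ) : ℂ) := by push_cast; rfl
          rw [this, Complex.ofReal_re]
          have := Real.pi_ne_zero
          simp only [smul_eq_mul]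
          field_simp
        · congr 1; ring
      · exact intervalIntegrable_const
      · exact (hc.const_mul _ |>.intervalIntegrable _ _)
    · have : Continuous fun φ : ℝ => (1 / (2 * Real.pi) : ℂ) + z / (2 * Real.pi) * (((Real.cos φ : ℝ) : ℂ) / 2 - z)⁻¹ := by fun_prop
      exact (this.intervalIntegrable 0 (2 * Real.pi)).1

/-- the oscillatory kernel -/
lemma aux_kernel (u ε : ℝ) (hε : 0 < ε) :
    (∫ t : ℝ, -Complex.I * (Real.sign t : ℂ) * Complex.exp (-(2 * Real.pi * ε * |t| : ℝ)) *
      Complex.exp (2 * Real.pi * Complex.I * t * u)) =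
      ((Real.pi⁻¹ * (u / (u ^ 2 + ε ^ 2)) : ℝ) : ℂ) := by
  have hpi : (Real.pi : ℂ) ≠ 0 := by exact_mod_cast Real.pi_ne_zero
  set a : ℂ := -(2 * Real.pi * ε) + 2 * Real.pi * u * Complex.I with ha
  set b : ℂ := (2 * Real.pi * ε) + 2 * Real.pi * u * Complex.I with hb
  have hare : a.re < 0 := by
    simp [ha]; positivity
  have hbre : 0 < b.re := by
    simp [hb]; positivity
  have hI : ∀ t ∈ Set.Ioi (0:ℝ), -Complex.I * (Real.sign t : ℂ) * Complex.exp (-(2 * Real.pi * ε * |t| : ℝ)) *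
      Complex.exp (2 * Real.pi * Complex.I * t * u) = -Complex.I * Complex.exp (a * t) := by
    intro t ht
    have ht' : (0:ℝ) < t := ht
    rw [Real.sign_of_pos ht', abs_of_pos ht', mul_assoc, ← Complex.exp_add, ha]
    push_cast
    rw [mul_one]
    congr 2; ring
  have hJ : ∀ t ∈ Set.Iic (0:ℝ), t ≠ 0 → -Complex.I * (Real.sign t : ℂ) * Complex.exp (-(2 * Real.pi * ε * |t| : ℝ)) *
      Complex.exp (2 * Real.pi * Complex.I * t * u) = Complex.I * Complex.exp (b * t) := by
    intro t ht h0
    have ht' : t < 0 := lt_of_le_of_ne ht h0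
    rw [Real.sign_of_neg ht', abs_of_neg ht', mul_assoc, ← Complex.exp_add, hb]
    push_cast
    rw [mul_neg, mul_one, neg_neg]
    congr 2; ring
  have hJ' : ∀ᵐ t ∂(volume.restrict (Set.Iic (0:ℝ))), -Complex.I * (Real.sign t : ℂ) * Complex.exp (-(2 * Real.pi * ε * |t| : ℝ)) *
      Complex.exp (2 * Real.pi * Complex.I * t * u) = Complex.I * Complex.exp (b * t) := by
    rw [ae_restrict_iff' measurableSet_Iic]
    have : ∀ᵐ t : ℝ, t ≠ 0 := by simp [ae_iff]
    filter_upwards [this] with t ht hm using hJ t hm ht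
  have i1 : IntegrableOn (fun t : ℝ => -Complex.I * (Real.sign t : ℂ) * Complex.exp (-(2 * Real.pi * ε * |t| : ℝ)) *
      Complex.exp (2 * Real.pi * Complex.I * t * u)) (Set.Ioi 0) := by
    rw [integrableOn_congr_fun hI measurableSet_Ioi]
    exact (integrableOn_exp_mul_complex_Ioi hare 0).const_mul _
  have i2 : IntegrableOn (fun t : ℝ => -Complex.I * (Real.sign t : ℂ) * Complex.exp (-(2 * Real.pi * ε * |t| : ℝ)) *
      Complex.exp (2 * Real.pi * Complex.I * t * u)) (Set.Iic 0) := by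
    rw [integrableOn_congr_fun_ae hJ']
    exact (integrableOn_exp_mul_complex_Iic hbre 0).const_mul _
  rw [← intervalIntegral.integral_Iic_add_Ioi i2 i1, setIntegral_congr_fun measurableSet_Ioi hI, integral_congr_ae hJ',
    integral_const_mul, integral_const_mul, integral_exp_mul_complex_Ioi hare, integral_exp_mul_complex_Iic hbre]
  have ha0 : a ≠ 0 := by intro h; rw [h] at hare; simp at hare
  have hb0 : b ≠ 0 := by intro h; rw [h] at hbre; simp at hbre
  have hd : ((u:ℂ) ^ 2 + ε ^ 2) ≠ 0 := by
    have : u ^ 2 + ε ^ 2 ≠ 0 := by positivity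
    exact_mod_cast this
  have hab : a * b = -4 * Real.pi ^ 2 * ((u:ℂ) ^ 2 + ε ^ 2) := by
    rw [ha, hb]; linear_combination (4 * (Real.pi:ℂ)^2 * u^2) * Complex.I_sq
  have hsum : a + b = 4 * Real.pi * u * Complex.I := by rw [ha, hb]; ring
  push_cast
  simp only [mul_zero, Complex.exp_zero]
  have : Complex.I * (1 / b) + -Complex.I * (-1 / a) = Complex.I * (a + b) / (a * b) := by
    field_simp
  rw [this, hab, hsum]
  field_simp
  rw [Complex.I_sq]
  ring

/-- integrability of the exponential weight -/
lemma aux_exp_int (ε : ℝ) (hε : 0 < ε) : Integrable fun t : ℝ => Real.exp (-(2 * Real.pi * ε * |t|)) := by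
  have hc : 0 < 2 * Real.pi * ε := by positivity
  rw [← integrableOn_univ, ← Set.Iic_union_Ioi (a := (0:ℝ)), integrableOn_union]
  constructor
  · refine (integrableOn_congr_fun (g := fun t : ℝ => Real.exp ((2 * Real.pi * ε) * t)) ?_ measurableSet_Iic).2 (integrableOn_exp_mul_Iic hc 0)
    intro t ht
    simp only
    rw [abs_of_nonpos ht]; congr 1; ring
  · refine (integrableOn_congr_fun (g := fun t : ℝ => Real.exp (-(2 * Real.pi * ε) * t)) ?_ measurableSet_Ioi).2 (integrableOn_exp_mul_Ioi (by linarith) 0)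
    intro t ht
    simp only
    rw [abs_of_pos ht]; congr 1; ring

/-- Abel-regularised Hilbert transform -/
noncomputable def HilbE (F : ℝ → ℝ) (ε x : ℝ) : ℂ :=
  ∫ t : ℝ, -Complex.I * (Real.sign t : ℂ) * FT F t * Complex.exp (-(2 * Real.pi * ε * |t| : ℝ)) *
    Complex.exp (2 * Real.pi * Complex.I * t * x)

lemma aux_sign_meas : Measurable Real.sign := by
  unfold Real.sign
  exact Measurable.ite measurableSet_Iio measurable_const
    (Measurable.ite measurableSet_Ioi measurable_const measurable_const)

lemma aux_sign_norm (t : ℝ) : ‖(Real.sign t : ℂ)‖ ≤ 1 := by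
  rcases Real.sign_apply_eq t with h | h | h <;> simp [h]

lemma aux_osc_norm (t x : ℝ) : ‖Complex.exp (2 * Real.pi * Complex.I * t * x)‖ = 1 := by
  rw [show (2 * Real.pi * Complex.I * t * x : ℂ) = ((2 * Real.pi * t * x : ℝ) : ℂ) * Complex.I by push_cast; ring]
  exact Complex.norm_exp_ofReal_mul_I _

lemma aux_exp_norm (r : ℝ) : ‖Complex.exp (-(r : ℝ))‖ = Real.exp (-r) := by
  rw [Complex.norm_exp]; simp

lemma aux_norm (w : ℂ) (ε t x : ℝ) (hε : 0 ≤ ε) :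
    ‖-Complex.I * (Real.sign t : ℂ) * w * Complex.exp (-(2 * Real.pi * ε * |t| : ℝ)) *
    Complex.exp (2 * Real.pi * Complex.I * t * x)‖ ≤ ‖w‖ := by
  rw [norm_mul, norm_mul, norm_mul, norm_mul, aux_osc_norm, aux_exp_norm, norm_neg, Complex.norm_I]
  have h1 := aux_sign_norm t
  have h2 : Real.exp (-(2 * Real.pi * ε * |t|)) ≤ 1 := by
    rw [Real.exp_le_one_iff]; have : 0 ≤ 2 * Real.pi * ε * |t| := by positivity
    linarith
  rw [one_mul, mul_one]
  calc _ ≤ 1 * ‖w‖ * 1 := by gcongr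
    _ = ‖w‖ := by ring

lemma aux_meas (F : ℝ → ℝ) (hF : Integrable (FT F)) (ε x : ℝ) :
    AEStronglyMeasurable (fun t : ℝ => -Complex.I * (Real.sign t : ℂ) * FT F t * Complex.exp (-(2 * Real.pi * ε * |t| : ℝ)) *
    Complex.exp (2 * Real.pi * Complex.I * t * x)) := by
  have hs : Measurable fun t : ℝ => (Real.sign t : ℂ) := Complex.measurable_ofReal.comp aux_sign_meas
  have h1 := hF.aestronglyMeasurable
  refine ((((hs.const_mul (-Complex.I)).aestronglyMeasurable).mul h1).mul ?_).mul ?_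
  · exact (by fun_prop : Continuous fun t : ℝ => Complex.exp (-(2 * Real.pi * ε * |t| : ℝ))).aestronglyMeasurable
  · exact (by fun_prop : Continuous fun t : ℝ => Complex.exp (2 * Real.pi * Complex.I * t * x)).aestronglyMeasurable

lemma HilbE_zero (F : ℝ → ℝ) (x : ℝ) : HilbE F 0 x = HilbR F x := by
  simp [HilbE, HilbR]

lemma HilbE_norm (F : ℝ → ℝ) (hF : Integrable (FT F)) (ε x : ℝ) (hε : 0 ≤ ε) :
    ‖HilbE F ε x‖ ≤ ∫ t, ‖FT F t‖ :=
  norm_integral_le_of_norm_le hF.norm (Filter.Eventually.of_forall fun t => aux_norm _ _ _ _ hε)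

lemma HilbE_cont (F : ℝ → ℝ) (hF : Integrable (FT F)) (ε : ℝ) (hε : 0 ≤ ε) :
    Continuous (HilbE F ε) := by
  refine continuous_of_dominated (fun x => aux_meas F hF ε x)
    (fun x => Filter.Eventually.of_forall fun t => aux_norm _ _ _ _ hε) hF.norm
    (Filter.Eventually.of_forall fun t => by fun_prop)

lemma HilbE_tendsto (F : ℝ → ℝ) (hF : Integrable (FT F)) (x : ℝ) :
    Filter.Tendsto (fun ε => HilbE F ε x) (nhdsWithin 0 (Set.Ioi 0)) (nhds (HilbR F x)) := by
  rw [← HilbE_zero]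
  refine tendsto_integral_filter_of_dominated_convergence (fun t => ‖FT F t‖)
    (Filter.Eventually.of_forall fun ε => aux_meas F hF ε x) ?_ hF.norm ?_
  · filter_upwards [self_mem_nhdsWithin] with ε hε
    exact Filter.Eventually.of_forall fun t => aux_norm _ _ _ _ (le_of_lt hε)
  · refine Filter.Eventually.of_forall fun t => ?_
    have : Continuous fun ε : ℝ => -Complex.I * (Real.sign t : ℂ) * FT F t * Complex.exp (-(2 * Real.pi * ε * |t| : ℝ)) *
      Complex.exp (2 * Real.pi * Complex.I * t * x) := by fun_prop
    exact (this.tendsto 0).mono_left nhdsWithin_le_nhds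

lemma HilbE_eq (F : ℝ → ℝ) (hF : Integrable F) (hc : Continuous F) (ε x : ℝ) (hε : 0 < ε) :
    HilbE F ε x = ∫ y, (F y : ℂ) * ((Real.pi⁻¹ * ((x - y) / ((x - y) ^ 2 + ε ^ 2)) : ℝ) : ℂ) := by
  have hs : Measurable fun t : ℝ => (Real.sign t : ℂ) := Complex.measurable_ofReal.comp aux_sign_meas
  set K : ℝ → ℝ → ℂ := fun t y => (F y : ℂ) * (-Complex.I * (Real.sign t : ℂ) * Complex.exp (-(2 * Real.pi * ε * |t| : ℝ)) *
      Complex.exp (2 * Real.pi * Complex.I * t * (x - y : ℝ))) with hK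
  have h1 : HilbE F ε x = ∫ t, ∫ y, K t y := by
    rw [HilbE]
    congr 1; ext t
    rw [FT, ← integral_const_mul, ← integral_mul_const, ← integral_mul_const]
    congr 1; ext y
    have : Complex.exp (2 * Real.pi * Complex.I * t * (x - y : ℝ)) =
      Complex.exp (-(2 * Real.pi * Complex.I) * t * y) * Complex.exp (2 * Real.pi * Complex.I * t * x) := by
      rw [← Complex.exp_add]; congr 1; push_cast; ring
    simp only [hK, this]
    ring
  have hint : Integrable (Function.uncurry K) (volume.prod volume) := by
    refine Integrable.mono' ((aux_exp_int ε hε).mul_prod hF.norm) ?_ ?_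
    · have : Measurable (Function.uncurry K) := by
        simp only [hK, Function.uncurry_def]
        have a1 : Measurable fun p : ℝ × ℝ => (F p.2 : ℂ) := (by fun_prop : Continuous fun p : ℝ × ℝ => (F p.2 : ℂ)).measurable
        have a2 : Measurable fun p : ℝ × ℝ => (Real.sign p.1 : ℂ) := hs.comp measurable_fst
        have a3 : Measurable fun p : ℝ × ℝ => Complex.exp (-(2 * Real.pi * ε * |p.1| : ℝ)) :=
          (by fun_prop : Continuous _).measurable
        have a4 : Measurable fun p : ℝ × ℝ => Complex.exp (2 * Real.pi * Complex.I * p.1 * (x - p.2 : ℝ)) :=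
          (by fun_prop : Continuous _).measurable
        exact a1.mul (((a2.const_mul _).mul a3).mul a4)
      exact this.aestronglyMeasurable
    · refine Filter.Eventually.of_forall fun p => ?_
      simp only [hK, Function.uncurry_def]
      rw [norm_mul, norm_mul, norm_mul, norm_mul, aux_osc_norm, aux_exp_norm, norm_neg, Complex.norm_I, one_mul, mul_one,
        Complex.norm_real, mul_comm]
      have := aux_sign_norm p.1
      calc _ ≤ (1 * Real.exp (-(2 * Real.pi * ε * |p.1|))) * ‖F p.2‖ := by gcongr
        _ = _ := by rw [one_mul]
  rw [h1, integral_integral_swap hint]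
  congr 1; ext y
  simp only [hK]
  rw [integral_const_mul, aux_kernel _ _ hε]

/-- Fubini in the angle -/
lemma HilbE_angle (F : ℝ → ℝ) (hF : Integrable F) (hc : Continuous F) (ε : ℝ) (hε : 0 < ε) :
    (∫ φ in (0:ℝ)..2 * Real.pi, ((Real.cos φ / 4 : ℝ) : ℂ) * HilbE F ε (Real.cos φ / 2)) =
     ((∫ y, F y * (∫ φ in (0:ℝ)..2 * Real.pi, (Real.cos φ / 4) *
      (Real.pi⁻¹ * ((Real.cos φ / 2 - y) / ((Real.cos φ / 2 - y) ^ 2 + ε ^ 2)))) : ℝ) : ℂ) := by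
  set K : ℝ → ℝ → ℝ := fun φ y => F y * ((Real.cos φ / 4) *
      (Real.pi⁻¹ * ((Real.cos φ / 2 - y) / ((Real.cos φ / 2 - y) ^ 2 + ε ^ 2)))) with hK
  have h1 : ∀ φ : ℝ, ((Real.cos φ / 4 : ℝ) : ℂ) * HilbE F ε (Real.cos φ / 2) = ((∫ y, K φ y : ℝ) : ℂ) := by
    intro φ
    rw [HilbE_eq F hF hc ε _ hε, ← integral_const_mul, ← integral_complex_ofReal]
    congr 1; ext y
    simp only [hK]
    push_cast; ring
  simp_rw [h1]
  rw [intervalIntegral.integral_ofReal]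
  congr 1
  have hcK : Continuous (Function.uncurry K) := by
    simp only [hK, Function.uncurry_def]
    have : ∀ p : ℝ × ℝ, (Real.cos p.1 / 2 - p.2) ^ 2 + ε ^ 2 ≠ 0 := fun p => by positivity
    fun_prop (disch := assumption)
  have hint : Integrable (Function.uncurry K) ((volume.restrict (Set.uIoc 0 (2 * Real.pi))).prod volume) := by
    have hcst : Integrable (fun _ : ℝ => (Real.pi⁻¹ * ε⁻¹)) (volume.restrict (Set.uIoc 0 (2 * Real.pi))) := by
      rw [Set.uIoc_of_le (by positivity)]
      exact integrable_const _
    refine Integrable.mono' (hcst.mul_prod hF.norm) hcK.aestronglyMeasurable ?_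
    refine Filter.Eventually.of_forall fun p => ?_
    simp only [hK, Function.uncurry_def]
    rw [norm_mul, mul_comm]
    gcongr
    rw [norm_mul, norm_mul]
    have b1 : ‖Real.cos p.1 / 4‖ ≤ 1 := by
      rw [Real.norm_eq_abs, abs_le]
      constructor <;> linarith [Real.cos_le_one p.1, Real.neg_one_le_cos p.1]
    have b2 : ‖(Real.cos p.1 / 2 - p.2) / ((Real.cos p.1 / 2 - p.2) ^ 2 + ε ^ 2)‖ ≤ ε⁻¹ := by
      generalize Real.cos p.1 / 2 - p.2 = u
      rw [Real.norm_eq_abs, abs_div, abs_of_pos (by positivity : 0 < u ^ 2 + ε ^ 2), div_le_iff₀ (by positivity),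
        inv_mul_eq_div, le_div_iff₀ hε]
      nlinarith [sq_nonneg (|u| - ε), sq_abs u, abs_nonneg u]
    have b3 : ‖Real.pi⁻¹‖ = Real.pi⁻¹ := by rw [Real.norm_eq_abs, abs_of_pos (by positivity)]
    rw [b3]
    calc _ ≤ 1 * (Real.pi⁻¹ * ε⁻¹) := by gcongr
      _ = _ := one_mul _
  rw [intervalIntegral_integral_swap hint]
  congr 1; ext y
  simp only [hK]
  rw [intervalIntegral.integral_const_mul]

noncomputable def Psi (ε y : ℝ) : ℝ := ∫ φ in (0:ℝ)..2 * Real.pi, (Real.cos φ / 4) *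
      (Real.pi⁻¹ * ((Real.cos φ / 2 - y) / ((Real.cos φ / 2 - y) ^ 2 + ε ^ 2)))

lemma Psi_sq (ε y : ℝ) (hε : 0 < ε) (hy : y ^ 2 < 1 / 4) :
    (Psi ε y - 1) ^ 2 = (‖((y : ℂ) + ε * Complex.I) ^ 2 / (((y : ℂ) + ε * Complex.I) ^ 2 - 1 / 4)‖
      + (((y : ℂ) + ε * Complex.I) ^ 2 / (((y : ℂ) + ε * Complex.I) ^ 2 - 1 / 4)).re) / 2 := by
  obtain ⟨w, hw, hP⟩ := aux_psi y ε hε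
  set z : ℂ := (y : ℂ) + ε * Complex.I with hz
  have hne : z ^ 2 - 1 / 4 ≠ 0 := by
    intro h
    have := congrArg Complex.re h
    rw [hz] at this
    simp [pow_two] at this
    nlinarith
  have hw2 : z ^ 2 / (z ^ 2 - 1 / 4) = w ^ 2 := by rw [div_eq_iff hne, hw]
  rw [hw2, Psi, hP, norm_pow, Complex.sq_norm, Complex.normSq_apply, pow_two w, Complex.mul_re]
  ring

lemma Psi_tendsto (y : ℝ) (hy : y ^ 2 < 1 / 4) :
    Filter.Tendsto (fun ε => Psi ε y) (nhdsWithin 0 (Set.Ioi 0)) (nhds 1) := by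
  have hne : ((y : ℂ) + (0:ℝ) * Complex.I) ^ 2 - 1 / 4 ≠ 0 := by
    intro h
    have := congrArg Complex.re h
    simp [pow_two] at this
    nlinarith
  have hg : ContinuousAt (fun ε : ℝ => ((y : ℂ) + ε * Complex.I) ^ 2 / (((y : ℂ) + ε * Complex.I) ^ 2 - 1 / 4)) 0 := by
    refine ContinuousAt.div ?_ ?_ hne <;> fun_prop
  have h2 : ContinuousAt (fun ε : ℝ => (‖((y : ℂ) + ε * Complex.I) ^ 2 / (((y : ℂ) + ε * Complex.I) ^ 2 - 1 / 4)‖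
      + (((y : ℂ) + ε * Complex.I) ^ 2 / (((y : ℂ) + ε * Complex.I) ^ 2 - 1 / 4)).re) / 2) 0 :=
    (hg.norm.add (Complex.continuous_re.continuousAt.comp hg)).div_const 2
  have h0 : (‖((y : ℂ) + (0:ℝ) * Complex.I) ^ 2 / (((y : ℂ) + (0:ℝ) * Complex.I) ^ 2 - 1 / 4)‖
      + (((y : ℂ) + (0:ℝ) * Complex.I) ^ 2 / (((y : ℂ) + (0:ℝ) * Complex.I) ^ 2 - 1 / 4)).re) / 2 = 0 := by
    have : ((y : ℂ) + (0:ℝ) * Complex.I) ^ 2 / (((y : ℂ) + (0:ℝ) * Complex.I) ^ 2 - 1 / 4)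
      = ((y ^ 2 / (y ^ 2 - 1 / 4) : ℝ) : ℂ) := by push_cast; simp
    rw [this, Complex.norm_real, Complex.ofReal_re, Real.norm_eq_abs, abs_of_nonpos]
    · ring
    · exact div_nonpos_of_nonneg_of_nonpos (sq_nonneg y) (by linarith)
  have h3 : Filter.Tendsto (fun ε => (Psi ε y - 1) ^ 2) (nhdsWithin 0 (Set.Ioi 0)) (nhds 0) := by
    have := h2.tendsto
    rw [h0] at this
    refine (this.mono_left nhdsWithin_le_nhds).congr' ?_
    filter_upwards [self_mem_nhdsWithin] with ε hε
    exact (Psi_sq ε y hε hy).symm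
  have h4 : Filter.Tendsto (fun ε => |Psi ε y - 1|) (nhdsWithin 0 (Set.Ioi 0)) (nhds 0) := by
    have := h3.sqrt
    simpa [Real.sqrt_sq_eq_abs] using this
  have h5 := (tendsto_zero_iff_abs_tendsto_zero _).2 h4
  have := h5.add_const 1
  simpa using this

lemma Psi_bound (ε y : ℝ) (hε : 0 < ε) (hε1 : ε < 1) (hy : y ^ 2 < 1 / 4) :
    |Psi ε y| ≤ 1 + 2 * (2 / √(1 - (2 * y) ^ 2)) := by
  have h := Psi_sq ε y hε hy
  set z : ℂ := (y : ℂ) + ε * Complex.I with hz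
  have hns : ‖z‖ ^ 2 = y ^ 2 + ε ^ 2 := by
    rw [Complex.sq_norm, Complex.normSq_apply, hz]; simp; ring
  have hlow : 1 / 4 - y ^ 2 ≤ ‖z ^ 2 - 1 / 4‖ := by
    have h1 := Complex.abs_re_le_norm (z ^ 2 - 1 / 4)
    have h2 : (z ^ 2 - 1 / 4).re = y ^ 2 - ε ^ 2 - 1 / 4 := by
      rw [hz]; simp [pow_two]
    rw [h2] at h1
    have := neg_le_abs (y ^ 2 - ε ^ 2 - 1 / 4)
    nlinarith
  have hd : 0 < 1 / 4 - y ^ 2 := by linarith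
  have hb : (Psi ε y - 1) ^ 2 ≤ ‖z ^ 2 / (z ^ 2 - 1 / 4)‖ := by
    rw [h]
    have := Complex.re_le_norm (z ^ 2 / (z ^ 2 - 1 / 4))
    linarith
  have hb2 : (Psi ε y - 1) ^ 2 ≤ 4 / (1 / 4 - y ^ 2) := by
    refine hb.trans ?_
    rw [norm_div, norm_pow, hns]
    have : y ^ 2 + ε ^ 2 ≤ 4 := by nlinarith
    gcongr
  have hs : (2 * (2 / √(1 - (2 * y) ^ 2))) ^ 2 = 4 / (1 / 4 - y ^ 2) := by
    rw [mul_pow, div_pow, Real.sq_sqrt (by nlinarith)]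
    have : (1 - (2 * y) ^ 2) ≠ 0 := by nlinarith
    have := hd.ne'
    field_simp
    ring
  have h6 : |Psi ε y - 1| ≤ 2 * (2 / √(1 - (2 * y) ^ 2)) := by
    apply abs_le_of_sq_le_sq
    · rw [hs]; exact hb2
    · positivity
  calc |Psi ε y| = |1 + (Psi ε y - 1)| := by ring_nf
    _ ≤ |(1:ℝ)| + |Psi ε y - 1| := abs_add_le _ _
    _ ≤ _ := by rw [abs_one]; linarith

lemma Psi_cont (ε : ℝ) (hε : 0 < ε) : Continuous (Psi ε) := by
  unfold Psi
  apply intervalIntegral.continuous_parametric_intervalIntegral_of_continuous'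
  simp only [Function.uncurry_def]
  have : ∀ p : ℝ × ℝ, (Real.cos p.2 / 2 - p.1) ^ 2 + ε ^ 2 ≠ 0 := fun p => by positivity
  fun_prop (disch := assumption)

lemma aux_arcsin_int : IntegrableOn (fun y : ℝ => 2 / √(1 - (2 * y) ^ 2)) (Set.Icc (-(1/2)) (1/2)) := by
  rw [integrableOn_Icc_iff_integrableOn_Ioc]
  refine intervalIntegral.integrableOn_deriv_of_nonneg (g := fun y => Real.arcsin (2 * y)) (by fun_prop) ?_ ?_
  · intro y hy
    have := (Real.hasDerivAt_arcsin (x := 2 * y) (by have := hy.1; intro h; linarith) (by have := hy.2; intro h; linarith)).comp y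
      ((hasDerivAt_id y).const_mul 2)
    have e : 1 / √(1 - (2 * y) ^ 2) * (2 * 1) = 2 / √(1 - (2 * y) ^ 2) := by ring
    rw [← e]
    exact this
  · intro y hy; positivity

lemma aux_key (F : ℝ → ℝ) (hF : memA F) :
    (∫ φ in (0:ℝ)..2 * Real.pi, ((Real.cos φ / 4 : ℝ) : ℂ) * HilbR F (Real.cos φ / 2)) = ((∫ y, F y : ℝ) : ℂ) := by
  obtain ⟨hc, -, hnn, hsupp, hFT⟩ := hF
  have hcs : HasCompactSupport F := HasCompactSupport.intro isCompact_Icc hsupp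
  have hint : Integrable F := hc.integrable_of_hasCompactSupport hcs
  obtain ⟨M, hM⟩ := hc.bounded_above_of_compact_support hcs
  have hlhs : Filter.Tendsto (fun ε => ∫ φ in (0:ℝ)..2 * Real.pi, ((Real.cos φ / 4 : ℝ) : ℂ) * HilbE F ε (Real.cos φ / 2))
      (nhdsWithin 0 (Set.Ioi 0)) (nhds (∫ φ in (0:ℝ)..2 * Real.pi, ((Real.cos φ / 4 : ℝ) : ℂ) * HilbR F (Real.cos φ / 2))) := by
    refine intervalIntegral.tendsto_integral_filter_of_dominated_convergence (fun _ => ∫ t, ‖FT F t‖) ?_ ?_ ?_ ?_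
    · filter_upwards [self_mem_nhdsWithin] with ε hε
      have := HilbE_cont F hFT ε (le_of_lt hε)
      exact (by fun_prop : Continuous fun φ : ℝ => ((Real.cos φ / 4 : ℝ) : ℂ) * HilbE F ε (Real.cos φ / 2)).aestronglyMeasurable
    · filter_upwards [self_mem_nhdsWithin] with ε hε
      refine Filter.Eventually.of_forall fun φ _ => ?_
      rw [norm_mul, Complex.norm_real]
      have b1 : ‖Real.cos φ / 4‖ ≤ 1 := by
        rw [Real.norm_eq_abs, abs_le]
        constructor <;> linarith [Real.cos_le_one φ, Real.neg_one_le_cos φ]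
      have b2 := HilbE_norm F hFT ε (Real.cos φ / 2) (le_of_lt hε)
      calc _ ≤ 1 * ∫ t, ‖FT F t‖ := by gcongr
        _ = _ := one_mul _
    · exact intervalIntegrable_const
    · refine Filter.Eventually.of_forall fun φ _ => ?_
      exact (HilbE_tendsto F hFT _).const_mul _
  have hrhs : Filter.Tendsto (fun ε => ∫ y, F y * Psi ε y) (nhdsWithin 0 (Set.Ioi 0)) (nhds (∫ y, F y)) := by
    have hae : ∀ᵐ y : ℝ, y ≠ 1/2 ∧ y ≠ -(1/2) := by
      rw [Filter.eventually_and]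
      constructor <;> simp [ae_iff]
    have hcase : ∀ y : ℝ, y ≠ 1/2 ∧ y ≠ -(1/2) → F y = 0 ∨ y ^ 2 < 1 / 4 := by
      intro y hy
      by_cases h : y ∈ Set.Icc (-(1/2) : ℝ) (1/2)
      · right
        have h1 := lt_of_le_of_ne h.1 (Ne.symm hy.2)
        have h2 := lt_of_le_of_ne h.2 hy.1
        nlinarith
      · left; exact hsupp y h
    refine tendsto_integral_filter_of_dominated_convergence (fun y => |F y| * (1 + 2 * (2 / √(1 - (2 * y) ^ 2)))) ?_ ?_ ?_ ?_
    · filter_upwards [self_mem_nhdsWithin] with ε hε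
      exact (hc.mul (Psi_cont ε hε)).aestronglyMeasurable
    · filter_upwards [Ioo_mem_nhdsGT (zero_lt_one' ℝ)] with ε hε
      filter_upwards [hae] with y hy
      rcases hcase y hy with h | h
      · simp [h]
      · rw [norm_mul, Real.norm_eq_abs, Real.norm_eq_abs]
        gcongr
        exact Psi_bound ε y hε.1 hε.2 h
    · rw [← integrableOn_iff_integrable_of_support_subset (s := Set.Icc (-(1/2)) (1/2))]
      · refine Integrable.bdd_mul (c := M) ?_ ?_ ?_
        · refine Integrable.add ?_ (aux_arcsin_int.const_mul 2)
          exact integrable_const _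
        · exact (hc.abs).aestronglyMeasurable
        · exact Filter.Eventually.of_forall fun y => by simpa using hM y
      · intro y hy
        by_contra h
        apply hy
        simp [hsupp y h]
    · filter_upwards [hae] with y hy
      rcases hcase y hy with h | h
      · simp [h]
      · simpa using (Psi_tendsto y h).const_mul (F y)
  have hrhs' : Filter.Tendsto (fun ε => ((∫ y, F y * Psi ε y : ℝ) : ℂ)) (nhdsWithin 0 (Set.Ioi 0)) (nhds ((∫ y, F y : ℝ) : ℂ)) :=
    (Complex.continuous_ofReal.tendsto _).comp hrhs
  refine tendsto_nhds_unique hlhs (hrhs'.congr' ?_)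
  filter_upwards [self_mem_nhdsWithin] with ε hε
  exact (HilbE_angle F hint hc ε hε).symm

lemma FT_even (F : ℝ → ℝ) (h : ∀ x, F (-x) = F x) (t : ℝ) : FT F (-t) = FT F t := by
  unfold FT
  rw [← integral_neg_eq_self]
  congr 1; ext x
  rw [h]
  push_cast; ring_nf

lemma HilbR_zero (F : ℝ → ℝ) (h : ∀ x, F (-x) = F x) : HilbR F 0 = 0 := by
  have h1 : HilbR F 0 = - HilbR F 0 := by
    conv_lhs => rw [HilbR, ← integral_neg_eq_self]
    rw [HilbR, ← integral_neg]
    congr 1; ext t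
    rw [FT_even F h, Real.sign_neg]
    simp
  have h2 : (2:ℂ) * HilbR F 0 = 0 := by linear_combination h1
  simpa using h2

lemma aux_abs_cos : (∫ φ in (0:ℝ)..2 * Real.pi, |Real.cos φ| / 4) = 1 := by
  have hp := Real.pi_pos
  have hi : ∀ a b : ℝ, IntervalIntegrable (fun φ => |Real.cos φ| / 4) volume a b :=
    fun a b => (by fun_prop : Continuous fun φ => |Real.cos φ| / 4).intervalIntegrable _ _
  have e1 : (∫ φ in (0:ℝ)..Real.pi / 2, |Real.cos φ| / 4) = 1 / 4 := by
    rw [intervalIntegral.integral_congr (g := fun φ => Real.cos φ / 4)]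
    · rw [intervalIntegral.integral_div, integral_cos]; simp
    · intro φ hφ
      rw [Set.uIcc_of_le (by positivity)] at hφ
      simp only
      rw [abs_of_nonneg (Real.cos_nonneg_of_mem_Icc ⟨by linarith [hφ.1], hφ.2⟩)]
  have hs : Function.Periodic (fun φ => |Real.cos φ| / 4) Real.pi := by
    intro φ; simp [Real.cos_add_pi]
  have e2 : (∫ φ in (Real.pi / 2)..Real.pi, |Real.cos φ| / 4) = 1 / 4 := by
    rw [intervalIntegral.integral_congr (g := fun φ => - Real.cos φ / 4)]
    · rw [intervalIntegral.integral_div, intervalIntegral.integral_neg, integral_cos]; simp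
    · intro φ hφ
      rw [Set.uIcc_of_le (by linarith)] at hφ
      simp only
      rw [abs_of_nonpos (Real.cos_nonpos_of_pi_div_two_le_of_le hφ.1 (by linarith [hφ.2]))]
  have e3 : (∫ φ in (0:ℝ)..Real.pi, |Real.cos φ| / 4) = 1 / 2 := by
    rw [← intervalIntegral.integral_add_adjacent_intervals (hi _ _) (hi _ _), e1, e2]; norm_num
  have e4 : (∫ φ in (Real.pi)..2 * Real.pi, |Real.cos φ| / 4) = 1 / 2 := by
    have := hs.intervalIntegral_add_eq Real.pi 0
    rw [zero_add, e3, ← two_mul] at this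
    exact this
  rw [← intervalIntegral.integral_add_adjacent_intervals (hi 0 Real.pi) (hi _ _), e3, e4]; norm_num

/-- For every nonzero `F ∈ 𝒜` one has the strict inequality
`max{‖𝓗(F)‖_{L∞(ℝ)}, ‖𝓗(f_F)‖_{L∞(ℝ/ℤ)}} > ‖F‖_{L¹(ℝ)}`; in particular there is no
extremal function for the extremal problem (EP1), whose optimal constant is `1`. -/
theorem stmt3 (F : ℝ → ℝ) (hF : memA F) (hF0 : F ≠ 0) :
    (∫ x : ℝ, |F x|) < max (supHR F) (supHPer F 1) := by
  have hkey := aux_key F hF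
  obtain ⟨hc, hev, hnn, hsupp, hFT⟩ := hF
  have hcs : HasCompactSupport F := HasCompactSupport.intro isCompact_Icc hsupp
  have habs : (∫ x : ℝ, |F x|) = ∫ x, F x := by
    congr 1; ext x; exact abs_of_nonneg (hnn x)
  have hpos : 0 < ∫ x, F x := by
    obtain ⟨x, hx⟩ := Function.ne_iff.1 hF0
    exact hc.integral_pos_of_hasCompactSupport_nonneg_nonzero hcs hnn hx
  rw [habs]
  apply lt_max_of_lt_left
  have hcH : Continuous (HilbR F) := by
    have := HilbE_cont F hFT 0 le_rfl
    rwa [show HilbE F 0 = HilbR F from funext (HilbE_zero F)] at this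
  have hbdd : BddAbove (Set.range fun x => ‖HilbR F x‖) := by
    refine ⟨∫ t, ‖FT F t‖, ?_⟩
    rintro _ ⟨x, rfl⟩
    have := HilbE_norm F hFT 0 x le_rfl
    rwa [HilbE_zero] at this
  have hle : ∀ x, ‖HilbR F x‖ ≤ supHR F := fun x => le_ciSup hbdd x
  set A := supHR F with hA
  have hcn : Continuous fun φ : ℝ => |Real.cos φ| / 4 * ‖HilbR F (Real.cos φ / 2)‖ := by fun_prop
  have hcA : Continuous fun φ : ℝ => |Real.cos φ| / 4 * A := by fun_prop
  have h2pi : (0:ℝ) < 2 * Real.pi := by positivity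
  have hI : (∫ x, F x) ≤ ∫ φ in (0:ℝ)..2 * Real.pi, |Real.cos φ| / 4 * ‖HilbR F (Real.cos φ / 2)‖ := by
    have h1 : ‖((∫ y, F y : ℝ) : ℂ)‖ = ∫ y, F y := by
      rw [Complex.norm_real, Real.norm_eq_abs, abs_of_pos hpos]
    rw [← h1, ← hkey]
    refine (intervalIntegral.norm_integral_le_integral_norm h2pi.le).trans (le_of_eq ?_)
    congr 1; ext φ
    rw [norm_mul, Complex.norm_real, Real.norm_eq_abs, abs_div, abs_of_pos (by norm_num : (0:ℝ) < 4)]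
  have hAI : (∫ φ in (0:ℝ)..2 * Real.pi, |Real.cos φ| / 4 * A) = A := by
    rw [intervalIntegral.integral_mul_const, aux_abs_cos, one_mul]
  have hApos : 0 < A := by
    have : (∫ φ in (0:ℝ)..2 * Real.pi, |Real.cos φ| / 4 * ‖HilbR F (Real.cos φ / 2)‖) ≤ ∫ φ in (0:ℝ)..2 * Real.pi, |Real.cos φ| / 4 * A := by
      refine intervalIntegral.integral_mono_on h2pi.le (hcn.intervalIntegrable _ _) (hcA.intervalIntegrable _ _) ?_
      intro φ _
      have := hle (Real.cos φ / 2)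
      gcongr
    linarith
  refine hI.trans_lt ?_
  rw [← hAI]
  -- a point near `0` where the transform is strictly below `A`
  have hev0 : ∀ᶠ x in nhds (0:ℝ), ‖HilbR F x‖ < A := by
    have : ContinuousAt (fun x => ‖HilbR F x‖) 0 := hcH.norm.continuousAt
    apply this.eventually_lt continuousAt_const
    rw [HilbR_zero F hev]; simpa using hApos
  obtain ⟨δ, hδ, hball⟩ := Metric.eventually_nhds_iff.1 hev0
  set r := min (δ / 2) (1 / 4) with hr
  have hr0 : 0 < r := by positivity
  have hr1 : r ≤ 1 / 4 := min_le_right _ _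
  have hr2 : r < δ := lt_of_le_of_lt (min_le_left _ _) (by linarith)
  have hcos : Real.cos (Real.arccos (2 * r)) = 2 * r := Real.cos_arccos (by linarith) (by linarith)
  refine intervalIntegral.integral_lt_integral_of_continuousOn_of_le_of_exists_lt h2pi hcn.continuousOn hcA.continuousOn ?_
    ⟨Real.arccos (2 * r), ⟨Real.arccos_nonneg _, by linarith [Real.arccos_le_pi (2 * r), Real.pi_pos]⟩, ?_⟩
  · intro φ _
    have := hle (Real.cos φ / 2)
    gcongr
  · rw [hcos]
    have : ‖HilbR F (2 * r / 2)‖ < A := by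
      apply hball
      rw [Real.dist_eq, sub_zero, abs_of_pos (by positivity)]
      linarith
    have h3 : 0 < |2 * r| / 4 := by positivity
    gcongr
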